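/- Let n ≥ 1, p ≥ 2, let C• and C̃ be symmetric p-tensors on ℝ^n, let W ∈ ℝ^{n×n} be nonsingular, let s ∈ ℝ^n be nonzero, and set v = W^{-T}W^{-1}s. Then the unique symmetric p-tensor C+ minimizing ‖(C − C•)[W]^p‖_F over all symmetric p-tensors C satisfying C[s] = C̃[s] can be written as C+ = C• + P_sym(A ⊗ v), where A is the unique symmetric (p−1)-tensor satisfying P_sym(A ⊗ v)[s] = (C̃ − C•)[s]. -/

import Mathlib

open scoped BigOperators
open Matrix Filter

noncomputable section

/-- A `q`-tensor on `ℝ^n` (a multilinear map `(ℝ^n)^q → ℝ`), represented by its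
coefficient array on the standard basis. -/
abbrev Tensor (n q : ℕ) := (Fin q → Fin n) → ℝ

namespace Tensor

/-- Evaluation of a tensor (as a multilinear map) on the vectors `u 0, …, u (q-1)`. -/
def eval {n q : ℕ} (T : Tensor n q) (u : Fin q → (Fin n → ℝ)) : ℝ :=
  ∑ i : Fin q → Fin n, T i * ∏ k, u k (i k)

/-- A tensor is symmetric if it is invariant under all permutations of its arguments. -/
def Symm {n q : ℕ} (T : Tensor n q) : Prop :=
  ∀ σ : Equiv.Perm (Fin q), ∀ i : Fin q → Fin n, T (i ∘ σ) = T i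

/-- The Frobenius norm of a tensor: the Euclidean norm of its coefficient array. -/
def frobNorm {n q : ℕ} (T : Tensor n q) : ℝ :=
  Real.sqrt (∑ i : Fin q → Fin n, (T i) ^ 2)

/-- The Frobenius inner product of two tensors. -/
def finner {n q : ℕ} (T S : Tensor n q) : ℝ := ∑ i : Fin q → Fin n, T i * S i

/-- The symmetric projection `P_sym(T) = (1/q!) ∑_σ σ(T)`. -/
def psym {n q : ℕ} (T : Tensor n q) : Tensor n q :=
  fun i => ((Nat.factorial q : ℝ))⁻¹ * ∑ σ : Equiv.Perm (Fin q), T (i ∘ σ)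

/-- `T[W]^q`: apply the matrix `W` to every argument of `T`. -/
def applyMat {n q : ℕ} (T : Tensor n q) (W : Matrix (Fin n) (Fin n) ℝ) : Tensor n q :=
  fun j => ∑ i : Fin q → Fin n, T i * ∏ k, W (i k) (j k)

/-- `T[v]^j`: fix the first `j` arguments of `T` to the vector `v`,
yielding a `(q-j)`-tensor. -/
def fixMany {n q : ℕ} (T : Tensor n q) (v : Fin n → ℝ) (j : ℕ) : Tensor n (q - j) :=
  fun idx => ∑ i : Fin j → Fin n, (∏ k, v (i k)) *
    T (fun k => if h : (k : ℕ) < j then i ⟨k, h⟩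
        else idx ⟨(k : ℕ) - j, by have hk := k.isLt; omega⟩)

/-- The outer product of two tensors. -/
def outer {n a b : ℕ} (T : Tensor n a) (S : Tensor n b) : Tensor n (a + b) :=
  fun idx => T (fun k => idx (Fin.castAdd b k)) * S (fun k => idx (Fin.natAdd a k))

/-- Reindexing a tensor along an equality of orders. -/
def castOrder {n a b : ℕ} (h : a = b) (T : Tensor n a) : Tensor n b :=
  fun idx => T (fun k => idx (Fin.cast h k))

/-- Apply a matrix to the first argument of a tensor only. -/
def applyFirst {n q : ℕ} (hq : 0 < q) (T : Tensor n q) (M : Matrix (Fin n) (Fin n) ℝ) :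
    Tensor n q :=
  fun idx => ∑ i : Fin n, M i (idx ⟨0, hq⟩) * T (Function.update idx ⟨0, hq⟩ i)

end Tensor

/-- `⊗^j v`, the `j`-fold outer product of a vector `v` with itself. -/
def vpow {n : ℕ} (j : ℕ) (v : Fin n → ℝ) : Tensor n j := fun idx => ∏ k, v (idx k)

/-- The Euclidean (2-) norm of a vector in `ℝ^n`. -/
def vnorm {n : ℕ} (v : Fin n → ℝ) : ℝ := Real.sqrt (∑ i, v i ^ 2)

/-- The injective (2-) norm of a tensor:
the supremum of `|T[u_1,…,u_q]|` over unit vectors. -/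
def Tensor.inj2Norm {n q : ℕ} (T : Tensor n q) : ℝ :=
  sSup ((fun u => |T.eval u|) '' {u : Fin q → Fin n → ℝ | ∀ k, vnorm (u k) = 1})

/-- The spectral (operator 2-) norm of a matrix. -/
def specNorm {n : ℕ} (M : Matrix (Fin n) (Fin n) ℝ) : ℝ :=
  ‖Matrix.toEuclideanCLM (𝕜 := ℝ) M‖

/-- The orthogonal projection `I - w wᵀ / (wᵀ w)` onto the orthogonal complement of `w`. -/
def projPerp {n : ℕ} (w : Fin n → ℝ) : Matrix (Fin n) (Fin n) ℝ :=
  1 - (w ⬝ᵥ w)⁻¹ • Matrix.vecMulVec w w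

/-- `Cp` is a least-change symmetric update of `Cb` in the `W`-weighted Frobenius norm,
subject to the secant equation `Cp[s] = R`. -/
def IsSecantUpdate {n p : ℕ} (Cb : Tensor n p) (R : Tensor n (p - 1))
    (W : Matrix (Fin n) (Fin n) ℝ) (s : Fin n → ℝ) (Cp : Tensor n p) : Prop :=
  Cp.Symm ∧ Cp.fixMany s 1 = R ∧
    ∀ C : Tensor n p, C.Symm → C.fixMany s 1 = R →
      ((Cp - Cb).applyMat W).frobNorm ≤ ((C - Cb).applyMat W).frobNorm

/-- The explicit higher-order secant update formula of Theorem 1 (b):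
`C• + ∑_{j=1}^p (-1)^{j+1} C(p,j) (vᵀs)^{-j} P_sym((⊗^j v) ⊗ (C̃ - C•)[s]^j)`. -/
def hosuFormula {n p : ℕ} (Cb Ct : Tensor n p) (v s : Fin n → ℝ) : Tensor n p :=
  Cb + ∑ j ∈ (Finset.Icc 1 p).attach,
    ((-1 : ℝ) ^ ((j : ℕ) + 1) * (p.choose (j : ℕ) : ℝ) * ((v ⬝ᵥ s) ^ (j : ℕ))⁻¹) •
      Tensor.castOrder (Nat.add_sub_cancel' (Finset.mem_Icc.mp j.2).2)
        (Tensor.psym ((vpow (j : ℕ) v).outer ((Ct - Cb).fixMany s (j : ℕ))))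

/-- The coefficient array of the `q`-th derivative of `f : ℝ^n → ℝ`
(domain given the sup-norm product structure). -/
def derivTensorPi {n : ℕ} (q : ℕ) (f : (Fin n → ℝ) → ℝ) (x : Fin n → ℝ) : Tensor n q :=
  fun idx => iteratedFDeriv ℝ q f x (fun k => Pi.single (idx k) 1)

/-- The coefficient array of the `q`-th derivative of `f : ℝ^n → ℝ`
(domain given the Euclidean structure). -/
def derivTensorE {n : ℕ} (q : ℕ) (f : EuclideanSpace ℝ (Fin n) → ℝ)
    (x : EuclideanSpace ℝ (Fin n)) : Tensor n q :=
  fun idx => iteratedFDeriv ℝ q f x (fun k => EuclideanSpace.single (idx k) 1)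

/-- Reinterpret a Euclidean vector as a plain vector in `Fin n → ℝ`. -/
def toVec {n : ℕ} (y : EuclideanSpace ℝ (Fin n)) : Fin n → ℝ := y

namespace Tensor

variable {n q : ℕ}

/-- Contraction of the first argument of a tensor with a vector. -/
def contract (T : Tensor n (q + 1)) (s : Fin n → ℝ) : Tensor n q :=
  fun idx => ∑ a, s a * T (Fin.cons a idx)

theorem fixMany_one (T : Tensor n (q + 1)) (s : Fin n → ℝ) :
    T.fixMany s 1 = T.contract s := by
  funext idx
  refine Fintype.sum_equiv (Equiv.funUnique (Fin 1) (Fin n)) _ _ fun i => ?_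
  rw [Fin.prod_univ_one]
  congr 2
  funext k
  refine Fin.cases ?_ (fun k => ?_) k
  · rfl
  · rw [dif_neg (by simp), Fin.cons_succ]
    rfl

theorem outer_vpow_one_snoc (A : Tensor n q) (v : Fin n → ℝ) (idx : Fin q → Fin n) (a : Fin n) :
    A.outer (vpow 1 v) (Fin.snoc (α := fun _ => Fin n) idx a) = A idx * v a := by
  have h1 : (fun k : Fin q => Fin.snoc (α := fun _ => Fin n) idx a (Fin.castAdd 1 k)) = idx := by
    funext k
    exact Fin.snoc_castSucc (α := fun _ => Fin n) a idx k
  have h2 : Fin.snoc (α := fun _ => Fin n) idx a (Fin.natAdd q (0 : Fin 1)) = a :=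
    Fin.snoc_last (α := fun _ => Fin n) a idx
  simp only [outer, vpow, Fin.prod_univ_one, h1, h2]

theorem sum_cons {M : Type*} [AddCommMonoid M] (f : (Fin (q + 1) → Fin n) → M) :
    ∑ i, f i = ∑ a, ∑ idx : Fin q → Fin n, f (Fin.cons a idx) := by
  rw [← Fintype.sum_prod_type']
  exact (Fintype.sum_equiv (Fin.consEquiv fun _ => Fin n) _ _ fun _ => rfl).symm

theorem sum_snoc {M : Type*} [AddCommMonoid M] (f : (Fin (q + 1) → Fin n) → M) :
    ∑ i, f i = ∑ a, ∑ idx : Fin q → Fin n, f (Fin.snoc (α := fun _ => Fin n) idx a) := by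
  rw [← Fintype.sum_prod_type']
  exact (Fintype.sum_equiv (Fin.snocEquiv fun _ => Fin n) _ _ fun _ => rfl).symm

theorem Symm.add {T S : Tensor n q} (hT : T.Symm) (hS : S.Symm) : (T + S).Symm := fun σ i => by
  simp only [Pi.add_apply, hT σ i, hS σ i]

theorem Symm.sub {T S : Tensor n q} (hT : T.Symm) (hS : S.Symm) : (T - S).Symm := fun σ i => by
  simp only [Pi.sub_apply, hT σ i, hS σ i]

theorem Symm.psym (T : Tensor n q) : T.psym.Symm := fun τ i => by
  simp only [Tensor.psym]
  congr 1
  exact Fintype.sum_equiv (Equiv.mulLeft τ) _ _ fun σ => rfl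

theorem Symm.contract {T : Tensor n (q + 1)} (hT : T.Symm) (s : Fin n → ℝ) :
    (T.contract s).Symm := fun σ i => by
  refine Finset.sum_congr rfl fun a _ => ?_
  rw [← hT (Equiv.Perm.decomposeFin.symm (0, σ)) (Fin.cons a i)]
  congr 2
  funext k
  refine Fin.cases ?_ (fun k => ?_) k <;> simp

theorem Symm.applyMat {T : Tensor n q} (hT : T.Symm) (W : Matrix (Fin n) (Fin n) ℝ) :
    (T.applyMat W).Symm := fun σ j => by
  refine (Fintype.sum_equiv (Equiv.arrowCongr σ.symm (Equiv.refl (Fin n))) _ _ fun i => ?_).symm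
  change T i * _ = T (i ∘ σ) * ∏ k, W (i (σ k)) (j (σ k))
  rw [hT σ i, Equiv.prod_comp σ fun k => W (i k) (j k)]

theorem Symm.snoc {T : Tensor n (q + 1)} (hT : T.Symm) (idx : Fin q → Fin n) (a : Fin n) :
    T (Fin.snoc (α := fun _ => Fin n) idx a) = T (Fin.cons a idx) := by
  rw [Fin.snoc_eq_cons_rotate]
  exact hT (finRotate _) (Fin.cons a idx)

theorem finner_comp_perm (T S : Tensor n q) (hS : S.Symm) (σ : Equiv.Perm (Fin q)) :
    ∑ i, T (i ∘ σ) * S i = finner T S := by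
  refine Fintype.sum_equiv (Equiv.arrowCongr σ.symm (Equiv.refl (Fin n))) _ _ fun i => ?_
  change _ = T (i ∘ σ) * S (i ∘ σ)
  rw [hS σ i]

theorem finner_psym (T S : Tensor n q) (hS : S.Symm) : finner T.psym S = finner T S := by
  have h : (Nat.factorial q : ℝ) ≠ 0 := by positivity
  simp only [finner, psym, mul_assoc, Finset.sum_mul]
  rw [← Finset.mul_sum, Finset.sum_comm]
  simp only [finner_comp_perm T S hS, Finset.sum_const, Finset.card_univ, Fintype.card_perm,
    Fintype.card_fin, nsmul_eq_mul]
  rw [inv_mul_cancel_left₀ h]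
  rfl

theorem finner_outer_vpow_one (A : Tensor n q) (v : Fin n → ℝ) (S : Tensor n (q + 1))
    (hS : S.Symm) : finner (A.outer (vpow 1 v)) S = finner A (S.contract v) := by
  simp only [finner, contract, Finset.mul_sum]
  rw [sum_snoc, Finset.sum_comm]
  refine Finset.sum_congr rfl fun idx _ => Finset.sum_congr rfl fun a _ => ?_
  rw [outer_vpow_one_snoc, hS.snoc, mul_assoc]

theorem finner_applyMat (T S : Tensor n q) (W : Matrix (Fin n) (Fin n) ℝ) :
    finner (T.applyMat W) S = finner T (S.applyMat Wᵀ) := by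
  simp only [finner, applyMat, Finset.mul_sum, Finset.sum_mul, Matrix.transpose_apply]
  rw [Finset.sum_comm]
  exact Finset.sum_congr rfl fun i _ => Finset.sum_congr rfl fun j _ => by ring

theorem applyMat_applyMat (T : Tensor n q) (W V : Matrix (Fin n) (Fin n) ℝ) :
    (T.applyMat W).applyMat V = T.applyMat (W * V) := by
  funext j
  simp only [applyMat, Finset.sum_mul]
  rw [Finset.sum_comm]
  refine Finset.sum_congr rfl fun i _ => ?_
  simp only [Matrix.mul_apply, Finset.prod_univ_sum, Fintype.piFinset_univ, Finset.mul_sum,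
    Finset.prod_mul_distrib, mul_assoc]

theorem applyMat_one (T : Tensor n q) : T.applyMat 1 = T := by
  funext j
  rw [applyMat, Finset.sum_eq_single j]
  · simp
  · intro i _ hij
    obtain ⟨k, hk⟩ := Function.ne_iff.mp hij
    exact mul_eq_zero_of_right _ (Finset.prod_eq_zero (Finset.mem_univ k) (Matrix.one_apply_ne hk))
  · simp

theorem applyMat_add (T S : Tensor n q) (W : Matrix (Fin n) (Fin n) ℝ) :
    (T + S).applyMat W = T.applyMat W + S.applyMat W := by
  funext j
  simp only [applyMat, Pi.add_apply, add_mul, Finset.sum_add_distrib]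

theorem zero_applyMat (W : Matrix (Fin n) (Fin n) ℝ) : (0 : Tensor n q).applyMat W = 0 := by
  funext j
  simp [applyMat]

theorem applyMat_eq_zero {T : Tensor n q} {W : Matrix (Fin n) (Fin n) ℝ} (hW : IsUnit W.det)
    (h : T.applyMat W = 0) : T = 0 := by
  rw [← applyMat_one T, ← Matrix.mul_nonsing_inv W hW, ← applyMat_applyMat, h, zero_applyMat]

theorem contract_applyMat (T : Tensor n (q + 1)) (G : Matrix (Fin n) (Fin n) ℝ)
    (v : Fin n → ℝ) : (T.applyMat G).contract v = (T.contract (G *ᵥ v)).applyMat G := by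
  funext idx
  simp only [contract, applyMat, sum_cons (fun i : Fin (q + 1) → Fin n => T i * _),
    Fin.prod_univ_succ, Fin.cons_zero, Fin.cons_succ, Matrix.mulVec, dotProduct,
    Finset.mul_sum, Finset.sum_mul]
  rw [Finset.sum_comm]
  conv_rhs => rw [Finset.sum_comm]
  refine Finset.sum_congr rfl fun b _ => ?_
  rw [Finset.sum_comm]
  exact Finset.sum_congr rfl fun i _ => Finset.sum_congr rfl fun a _ => by ring

theorem contract_add (T S : Tensor n (q + 1)) (s : Fin n → ℝ) :
    (T + S).contract s = T.contract s + S.contract s := by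
  funext idx
  simp only [contract, Pi.add_apply, mul_add, Finset.sum_add_distrib]

theorem contract_sub (T S : Tensor n (q + 1)) (s : Fin n → ℝ) :
    (T - S).contract s = T.contract s - S.contract s := by
  funext idx
  simp only [contract, Pi.sub_apply, mul_sub, Finset.sum_sub_distrib]

theorem contract_smul (c : ℝ) (T : Tensor n (q + 1)) (s : Fin n → ℝ) :
    (c • T).contract s = c • T.contract s := by
  funext idx
  simp only [contract, Pi.smul_apply, smul_eq_mul, Finset.mul_sum]
  exact Finset.sum_congr rfl fun a _ => by ring

theorem finner_self_eq_zero {T : Tensor n q} (h : finner T T = 0) : T = 0 := by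
  funext i
  have := (Finset.sum_eq_zero_iff_of_nonneg fun i _ => mul_self_nonneg (T i)).mp h i
    (Finset.mem_univ i)
  exact mul_self_eq_zero.mp this

theorem frobNorm_le_frobNorm {T S : Tensor n q} :
    frobNorm T ≤ frobNorm S ↔ finner T T ≤ finner S S := by
  simp only [frobNorm, finner, ← pow_two]
  exact Real.sqrt_le_sqrt_iff (Finset.sum_nonneg fun i _ => sq_nonneg _)

theorem finner_add_self (T S : Tensor n q) :
    finner (T + S) (T + S) = finner T T + 2 * finner T S + finner S S := by
  simp only [finner, Finset.mul_sum, ← Finset.sum_add_distrib, Pi.add_apply]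
  exact Finset.sum_congr rfl fun i _ => by ring

theorem finner_zero (T : Tensor n q) : finner T 0 = 0 := by simp [finner]

/-- The symmetric product `P_sym(A ⊗ v)` of a tensor and a vector. -/
def symMul (A : Tensor n q) (v : Fin n → ℝ) : Tensor n (q + 1) := psym (A.outer (vpow 1 v))

theorem symMul_add (A B : Tensor n q) (v : Fin n → ℝ) :
    (A + B).symMul v = A.symMul v + B.symMul v := by
  funext idx
  simp only [symMul, psym, outer, Pi.add_apply, add_mul, Finset.sum_add_distrib, mul_add]

theorem symMul_smul (c : ℝ) (A : Tensor n q) (v : Fin n → ℝ) :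
    (c • A).symMul v = c • A.symMul v := by
  funext idx
  simp only [symMul, psym, outer, Pi.smul_apply, smul_eq_mul, Finset.mul_sum]
  exact Finset.sum_congr rfl fun σ _ => by ring

theorem finner_symMul_applyMat (A : Tensor n q) {D : Tensor n (q + 1)} (hD : D.Symm)
    {W : Matrix (Fin n) (Fin n) ℝ} {v s : Fin n → ℝ} (hv : (W * Wᵀ) *ᵥ v = s)
    (hDs : D.contract s = 0) : finner ((A.symMul v).applyMat W) (D.applyMat W) = 0 := by
  rw [finner_applyMat, applyMat_applyMat, symMul, finner_psym _ _ (hD.applyMat _),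
    finner_outer_vpow_one _ _ _ (hD.applyMat _), contract_applyMat, hv, hDs, zero_applyMat,
    finner_zero]

open MvPolynomial in
/-- The homogeneous polynomial `x ↦ T[x, …, x]`. -/
def toMvPolynomial (T : Tensor n q) : MvPolynomial (Fin n) ℝ :=
  ∑ i, C (T i) * ∏ k, X (i k)

theorem toMvPolynomial_psym (T : Tensor n q) : T.psym.toMvPolynomial = T.toMvPolynomial := by
  have h : (Nat.factorial q : ℝ) ≠ 0 := by positivity
  have hσ (σ : Equiv.Perm (Fin q)) :
      ∑ i, MvPolynomial.C (T (i ∘ σ)) * ∏ k, MvPolynomial.X (i k) = T.toMvPolynomial := by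
    refine Fintype.sum_equiv (Equiv.arrowCongr σ.symm (Equiv.refl (Fin n))) _ _ fun i => ?_
    change _ = MvPolynomial.C (T (i ∘ σ)) * ∏ k, MvPolynomial.X (i (σ k))
    rw [Equiv.prod_comp σ fun k => MvPolynomial.X (i k)]
  rw [toMvPolynomial]
  simp only [psym, map_mul, map_sum, mul_assoc, Finset.sum_mul]
  rw [← Finset.mul_sum, Finset.sum_comm]
  simp only [hσ, Finset.sum_const, Finset.card_univ, Fintype.card_perm, Fintype.card_fin]
  rw [← Nat.cast_smul_eq_nsmul ℝ, ← MvPolynomial.smul_eq_C_mul, inv_smul_smul₀ h]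

theorem toMvPolynomial_outer_vpow_one (A : Tensor n q) (v : Fin n → ℝ) :
    toMvPolynomial (A.outer (vpow 1 v)) =
      A.toMvPolynomial * ∑ a, MvPolynomial.C (v a) * MvPolynomial.X a := by
  simp only [toMvPolynomial]
  rw [sum_snoc, Finset.sum_mul_sum, Finset.sum_comm]
  refine Finset.sum_congr rfl fun idx _ => Finset.sum_congr rfl fun a _ => ?_
  rw [outer_vpow_one_snoc, Fin.prod_univ_castSucc, map_mul]
  simp only [Fin.snoc_castSucc, Fin.snoc_last]
  ring

theorem exists_perm_of_sum_single_eq {α : Type*} {i j : Fin q → α}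
    (h : ∑ k, Finsupp.single (i k) 1 = ∑ k, Finsupp.single (j k) (1 : ℕ)) :
    ∃ σ : Equiv.Perm (Fin q), j ∘ σ = i := by
  classical
  have hcard (a : α) : Fintype.card {k // i k = a} = Fintype.card {k // j k = a} := by
    have := DFunLike.congr_fun h a
    simpa [Finsupp.finsetSum_apply, Finsupp.single_apply, Fintype.card_subtype] using this
  refine ⟨Equiv.ofFiberEquiv fun a => Fintype.equivOfCardEq (hcard a), ?_⟩
  funext k
  exact Equiv.ofFiberEquiv_map _ k

theorem Symm.eq_zero_of_toMvPolynomial {T : Tensor n q} (hT : T.Symm)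
    (h : T.toMvPolynomial = 0) : T = 0 := by
  classical
  funext j
  have hX (i : Fin q → Fin n) : ∏ k, (MvPolynomial.X (i k) : MvPolynomial (Fin n) ℝ) =
      MvPolynomial.monomial (∑ k, Finsupp.single (i k) 1) 1 := by
    rw [MvPolynomial.monomial_sum_one]
    rfl
  have hc := congrArg (MvPolynomial.coeff (∑ k, Finsupp.single (j k) 1)) h
  simp only [toMvPolynomial, hX, MvPolynomial.coeff_sum, MvPolynomial.coeff_C_mul,
    MvPolynomial.coeff_monomial, MvPolynomial.coeff_zero, mul_ite, mul_one, mul_zero] at hc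
  have hterm (i : Fin q → Fin n) :
      (if ∑ k, Finsupp.single (i k) 1 = ∑ k, Finsupp.single (j k) (1 : ℕ) then T i else 0) =
      (if ∑ k, Finsupp.single (i k) 1 = ∑ k, Finsupp.single (j k) (1 : ℕ) then 1 else 0) *
        T j := by
    split_ifs with hij
    · obtain ⟨σ, rfl⟩ := exists_perm_of_sum_single_eq hij
      rw [hT, one_mul]
    · rw [zero_mul]
  simp only [hterm] at hc
  rw [← Finset.sum_mul] at hc
  refine (mul_eq_zero.mp hc).resolve_left (ne_of_gt ?_)
  exact Finset.sum_pos' (fun i _ => by split_ifs <;> norm_num) ⟨j, Finset.mem_univ j, by simp⟩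

theorem Symm.eq_zero_of_symMul {A : Tensor n q} (hA : A.Symm) {v : Fin n → ℝ} (hv : v ≠ 0)
    (h : A.symMul v = 0) : A = 0 := by
  have hmul : A.toMvPolynomial * ∑ a, MvPolynomial.C (v a) * MvPolynomial.X a = 0 := by
    rw [← toMvPolynomial_outer_vpow_one, ← toMvPolynomial_psym]
    change (A.symMul v).toMvPolynomial = 0
    simp [h, toMvPolynomial]
  refine hA.eq_zero_of_toMvPolynomial ((mul_eq_zero.mp hmul).resolve_right fun hlin => hv ?_)
  funext a
  have := congrArg (MvPolynomial.eval (Pi.single a 1)) hlin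
  simpa [Pi.single_apply] using this

/-- The subspace of symmetric tensors. -/
def symmSubmodule (n q : ℕ) : Submodule ℝ (Tensor n q) where
  carrier := {T | T.Symm}
  add_mem' := Symm.add
  zero_mem' := fun _ _ => rfl
  smul_mem' := fun c T hT σ i => by simp only [Pi.smul_apply, hT σ i]

/-- The linear map `A ↦ P_sym(A ⊗ v)[s]` on symmetric tensors. -/
def contractSymMul (v s : Fin n → ℝ) : symmSubmodule n q →ₗ[ℝ] symmSubmodule n q where
  toFun A := ⟨(A.1.symMul v).contract s, (Symm.psym _).contract s⟩
  map_add' A B := Subtype.ext <| by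
    simp only [Submodule.coe_add, symMul_add, contract_add]
  map_smul' c A := Subtype.ext <| by
    simp only [Submodule.coe_smul, symMul_smul, contract_smul, RingHom.id_apply]

theorem contractSymMul_injective {W : Matrix (Fin n) (Fin n) ℝ} (hW : IsUnit W.det)
    {v s : Fin n → ℝ} (hv : (W * Wᵀ) *ᵥ v = s) (hs : s ≠ 0) :
    Function.Injective (contractSymMul (q := q) v s) := by
  rw [injective_iff_map_eq_zero]
  rintro ⟨A, hA⟩ h
  have hc : (A.symMul v).contract s = 0 := congrArg Subtype.val h
  have hv0 : v ≠ 0 := by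
    rintro rfl
    exact hs (by rw [← hv, Matrix.mulVec_zero])
  exact Subtype.ext <| hA.eq_zero_of_symMul hv0 <| applyMat_eq_zero hW <|
    finner_self_eq_zero <| finner_symMul_applyMat A (Symm.psym _) hv hc

theorem eq_of_isSecantUpdate {Cb Cp : Tensor n (q + 1)} {R : Tensor n q} (hCb : Cb.Symm)
    {W : Matrix (Fin n) (Fin n) ℝ} (hW : IsUnit W.det) {v s : Fin n → ℝ}
    (hv : (W * Wᵀ) *ᵥ v = s) (hCp : IsSecantUpdate Cb R W s Cp) {A : Tensor n q}
    (hA : (Cb + A.symMul v).contract s = R) : Cp = Cb + A.symMul v := by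
  obtain ⟨hsymm, hsec, hmin⟩ := hCp
  rw [fixMany_one] at hsec
  have hsymm' : (Cb + A.symMul v).Symm := hCb.add (Symm.psym _)
  have hle := frobNorm_le_frobNorm.mp (hmin _ hsymm' ((fixMany_one _ _).trans hA))
  have hD : (Cp - (Cb + A.symMul v)).contract s = 0 := by
    rw [contract_sub, hsec, hA, sub_self]
  rw [add_sub_cancel_left,
    show Cp - Cb = A.symMul v + (Cp - (Cb + A.symMul v)) by abel, applyMat_add,
    finner_add_self, finner_symMul_applyMat A (hsymm.sub hsymm') hv hD] at hle
  refine sub_eq_zero.mp (applyMat_eq_zero hW (finner_self_eq_zero (le_antisymm (by linarith) ?_)))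
  exact Finset.sum_nonneg fun i _ => mul_self_nonneg _

end Tensor

/-- the unique least-change symmetric update can be written as
`C• + P_sym(A ⊗ v)` for a unique symmetric `(p-1)`-tensor `A` satisfying
`P_sym(A ⊗ v)[s] = (C̃ - C•)[s]`, where `v = W⁻ᵀW⁻¹s`. -/
theorem statement2 (n p : ℕ) (hn : 1 ≤ n) (hp : 2 ≤ p)
    (Cb Ct : Tensor n p) (hCb : Cb.Symm) (hCt : Ct.Symm)
    (W : Matrix (Fin n) (Fin n) ℝ) (hW : IsUnit W.det)
    (s : Fin n → ℝ) (hs : s ≠ 0)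
    (Cp : Tensor n p) (hCp : IsSecantUpdate Cb (Ct.fixMany s 1) W s Cp) :
    ∃ A : Tensor n (p - 1), A.Symm ∧
      Cp = Cb + Tensor.castOrder (by omega : p - 1 + 1 = p)
        (Tensor.psym (A.outer (vpow 1 ((W⁻¹)ᵀ *ᵥ (W⁻¹ *ᵥ s))))) ∧
      (Tensor.castOrder (by omega : p - 1 + 1 = p)
          (Tensor.psym (A.outer (vpow 1 ((W⁻¹)ᵀ *ᵥ (W⁻¹ *ᵥ s)))))).fixMany s 1
        = (Ct - Cb).fixMany s 1 ∧
      ∀ A' : Tensor n (p - 1), A'.Symm →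
        (Tensor.castOrder (by omega : p - 1 + 1 = p)
            (Tensor.psym (A'.outer (vpow 1 ((W⁻¹)ᵀ *ᵥ (W⁻¹ *ᵥ s)))))).fixMany s 1
          = (Ct - Cb).fixMany s 1 → A' = A := by
  obtain ⟨q, rfl⟩ : ∃ q, p = q + 1 := ⟨p - 1, by omega⟩
  have hv : (W * Wᵀ) *ᵥ ((W⁻¹)ᵀ *ᵥ (W⁻¹ *ᵥ s)) = s := by
    rw [Matrix.mulVec_mulVec, Matrix.mulVec_mulVec, Matrix.mul_assoc W, ← Matrix.transpose_mul,
      Matrix.nonsing_inv_mul W hW, Matrix.transpose_one, Matrix.mul_one,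
      Matrix.mul_nonsing_inv W hW, Matrix.one_mulVec]
  generalize (W⁻¹)ᵀ *ᵥ (W⁻¹ *ᵥ s) = v at hv ⊢
  have hinj := Tensor.contractSymMul_injective (q := q) hW hv hs
  obtain ⟨⟨A, hA⟩, hAeq⟩ := LinearMap.injective_iff_surjective.mp hinj
    ⟨(Ct - Cb).contract s, (hCt.sub hCb).contract s⟩
  have hAs : (A.symMul v).contract s = (Ct - Cb).contract s := congrArg Subtype.val hAeq
  refine ⟨A, hA, ?_, ?_, fun A' hA' h => ?_⟩
  · refine Tensor.eq_of_isSecantUpdate hCb hW hv hCp ?_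
    rw [Tensor.contract_add, hAs, Tensor.contract_sub, Tensor.fixMany_one]
    abel
  · exact (Tensor.fixMany_one (A.symMul v) s).trans (hAs.trans (Tensor.fixMany_one _ s).symm)
  · have h' : (A'.symMul v).contract s = (Ct - Cb).contract s :=
      (Tensor.fixMany_one (A'.symMul v) s).symm.trans (h.trans (Tensor.fixMany_one _ s))
    exact congrArg Subtype.val (@hinj ⟨A', hA'⟩ ⟨A, hA⟩ (Subtype.ext (h'.trans hAs.symm)))
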